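/- arXiv:1101.0945 — 8 statements merged into one kernel-verified Lean document; each statement's English description precedes it below -/
import Mathlib

section
/- Let (Ω, 𝓕) be a measurable space, (P_n)_{n∈ℕ} a sequence of probability measures on (Ω, 𝓕), and for each n let X_n, S_n : Ω → ℝ be measurable and strictly positive P_n-a.s. Assume that ∫ S_n/X_n dP_n ≤ 1 for every n, and that for every M > 0, lim_{n→∞} P_n(S_n < M) = 0. Then for every N > 0, lim_{n→∞} P_n(X_n < N) = 0. -/
open Filter Set MeasureTheory

/-- wealth with the numéraire property relative to an exploding
safe asset is unbounded in probability. -/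
theorem numeraire_wealth_unbounded
    {Ω : Type*} [MeasurableSpace Ω] (P : ℕ → Measure Ω)
    (hP : ∀ n, IsProbabilityMeasure (P n))
    (X S : ℕ → Ω → ℝ)
    (hXm : ∀ n, Measurable (X n)) (hSm : ∀ n, Measurable (S n))
    (hXpos : ∀ n, ∀ᵐ ω ∂(P n), 0 < X n ω)
    (hSpos : ∀ n, ∀ᵐ ω ∂(P n), 0 < S n ω)
    (hnum : ∀ n, ∫⁻ ω, ENNReal.ofReal (S n ω / X n ω) ∂(P n) ≤ 1)
    (hS : ∀ M > (0:ℝ), Tendsto (fun n => P n {ω | S n ω < M}) atTop (nhds 0)) :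
    ∀ N > (0:ℝ), Tendsto (fun n => P n {ω | X n ω < N}) atTop (nhds 0) := by
  intro N hN
  rw [ENNReal.tendsto_nhds_zero]
  intro ε hε
  have hε2 : ε / 2 ≠ 0 := (ENNReal.half_pos hε.ne').ne'
  obtain ⟨k, hk⟩ := ENNReal.exists_inv_nat_lt hε2
  have hk_pos : (0:ℝ) < (k:ℝ) + 1 := by positivity
  filter_upwards [ENNReal.tendsto_nhds_zero.1 (hS (N * (k + 1)) (by positivity)) (ε / 2)
    (ENNReal.half_pos hε.ne')] with n hn
  have hsub : P n {ω | X n ω < N} ≤ P n ({ω | S n ω < N * (k + 1)} ∪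
      {ω | ENNReal.ofReal (k + 1) ≤ ENNReal.ofReal (S n ω / X n ω)}) := by
    refine measure_mono_ae ?_
    filter_upwards [hXpos n] with ω hX hXN
    rcases lt_or_ge (S n ω) (N * (k + 1)) with h | h
    · exact Or.inl h
    · refine Or.inr (ENNReal.ofReal_le_ofReal ?_)
      rw [le_div_iff₀ hX]
      have hXN' : X n ω < N := hXN
      nlinarith
  have hmarkov : P n {ω | ENNReal.ofReal (k + 1) ≤ ENNReal.ofReal (S n ω / X n ω)} ≤ ε / 2 := by
    calc P n {ω | ENNReal.ofReal (k + 1) ≤ ENNReal.ofReal (S n ω / X n ω)}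
        ≤ (∫⁻ ω, ENNReal.ofReal (S n ω / X n ω) ∂(P n)) / ENNReal.ofReal (k + 1) :=
          meas_ge_le_lintegral_div ((hSm n).div (hXm n)).ennreal_ofReal.aemeasurable
            (ENNReal.ofReal_pos.2 hk_pos).ne' ENNReal.ofReal_ne_top
      _ ≤ 1 / ENNReal.ofReal (k + 1) := by gcongr; exact hnum n
      _ ≤ (k : ENNReal)⁻¹ := by
          rw [one_div, ENNReal.inv_le_inv, ← ENNReal.ofReal_natCast]
          exact ENNReal.ofReal_le_ofReal (by linarith)
      _ ≤ ε / 2 := hk.le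
  calc P n {ω | X n ω < N} ≤ _ := hsub
    _ ≤ _ := measure_union_le _ _
    _ ≤ ε / 2 + ε / 2 := add_le_add hn hmarkov
    _ = ε := ENNReal.add_halves ε
end

section
/- Let I : (0,∞) → (0,∞) be nonincreasing with lim_{y→0+} y·I(y) = 1. Let (Ω, 𝓕, P) be a probability space, and for each n ∈ ℕ let Y_n : Ω → ℝ be measurable with Y_n > 0 P-a.s., and let α_n > 0 be constants such that E[Y_n · I(α_n Y_n)] = 1 for every n. If lim_{n→∞} E[Y_n] = 0, then limsup_{n→∞} α_n ≤ 1. -/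
open Filter Set MeasureTheory

/-- If `y * I y → 1` as `y → 0+` and `I` is nonincreasing, then `y * I y` grows at most linearly,
with intercept arbitrarily close to `1`. -/
lemma exists_mul_le_add_mul_of_tendsto_one {I : ℝ → ℝ} (hIanti : AntitoneOn I (Ioi 0))
    (hIpos : ∀ y ∈ Ioi (0:ℝ), 0 < I y)
    (hIasymp : Tendsto (fun y => y * I y) (nhdsWithin 0 (Ioi 0)) (nhds 1))
    {c : ℝ} (hc : 1 < c) :
    ∃ C, ∀ y, 0 < y → y * I y ≤ c + C * y := by
  obtain ⟨δ, hδ, hlt⟩ := mem_nhdsGT_iff_exists_Ioc_subset.1 (hIasymp.eventually_lt_const hc)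
  have hδ : 0 < δ := hδ
  refine ⟨I δ, fun y hy => ?_⟩
  have hIδ := hIpos δ hδ
  rcases le_total y δ with h | h
  · have : y * I y < c := hlt ⟨hy, h⟩
    nlinarith [mul_pos hIδ hy]
  · nlinarith [hIanti hδ (mem_Ioi.2 hy) h]

/-- asymptotics of Lagrange multipliers, logarithmic case (p = 0). -/
theorem lagrange_multiplier_log_case
    {Ω : Type*} [MeasurableSpace Ω] (P : Measure Ω) [IsProbabilityMeasure P]
    (I : ℝ → ℝ) (hIanti : AntitoneOn I (Ioi 0)) (hIpos : ∀ y ∈ Ioi (0:ℝ), 0 < I y)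
    (hIasymp : Tendsto (fun y => y * I y) (nhdsWithin 0 (Ioi 0)) (nhds 1))
    (Y : ℕ → Ω → ℝ) (α : ℕ → ℝ)
    (hYm : ∀ n, Measurable (Y n)) (hYpos : ∀ n, ∀ᵐ ω ∂P, 0 < Y n ω)
    (hαpos : ∀ n, 0 < α n)
    (hYint : ∀ n, Integrable (Y n) P)
    (hfocint : ∀ n, Integrable (fun ω => Y n ω * I (α n * Y n ω)) P)
    (hfoc : ∀ n, ∫ ω, Y n ω * I (α n * Y n ω) ∂P = 1)
    (hYto0 : Tendsto (fun n => ∫ ω, Y n ω ∂P) atTop (nhds 0)) :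
    limsup α atTop ≤ 1 := by
  refine le_of_forall_gt_imp_ge_of_dense fun b hb => ?_
  obtain ⟨c, hc, hcb⟩ := exists_between hb
  obtain ⟨C, hC⟩ := exists_mul_le_add_mul_of_tendsto_one hIanti hIpos hIasymp hc
  have hb0 : 0 < b := by linarith
  have hbudget : ∀ n, 1 ≤ c / α n + C * ∫ ω, Y n ω ∂P := by
    intro n
    have hint : Integrable (fun ω => c / α n + C * Y n ω) P :=
      (integrable_const _).add ((hYint n).const_mul C)
    have hle : ∀ᵐ ω ∂P, Y n ω * I (α n * Y n ω) ≤ c / α n + C * Y n ω := by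
      filter_upwards [hYpos n] with ω hω
      have h := hC (α n * Y n ω) (mul_pos (hαpos n) hω)
      have hα := hαpos n
      refine le_of_mul_le_mul_left ?_ hα
      rw [mul_add, mul_div_cancel₀ _ hα.ne']
      linarith
    have h := integral_mono_ae (hfocint n) hint hle
    rw [hfoc n, integral_add (integrable_const _) ((hYint n).const_mul C),
      integral_const_mul] at h
    simpa using h
  have hsmall : ∀ᶠ n in atTop, C * ∫ ω, Y n ω ∂P < 1 - c / b := by
    refine (hYto0.const_mul C).eventually_lt_const ?_
    rw [mul_zero, sub_pos, div_lt_one hb0]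
    exact hcb
  refine limsup_le_of_le
    (isCoboundedUnder_le_of_le atTop (x := 0) fun n => (hαpos n).le) ?_
  filter_upwards [hsmall] with n hn
  by_contra! hα
  have : c / α n ≤ c / b := by gcongr
  linarith [hbudget n]
end

section
/- Let p ∈ (0,1) and let U′ : (0,∞) → (0,∞) be a function with lim_{x→∞} U′(x)·x^{1−p} = 1. Let (Ω, 𝓕, P) be a probability space, and for each n ∈ ℕ let X_n : Ω → ℝ be measurable with X_n > 0 P-a.s., and let α_n > 0 be constants such that E[U′(X_n)·X_n] = α_n for every n. Assume that for every M > 0, lim_{n→∞} (1/α_n)·E[U′(X_n)·X_n·1_{{X_n ≤ M}}] = 0. Then liminf_{n→∞} (1/α_n)·E[X_n^p] ≥ 1 (the expectations E[X_n^p] being taken in [0,∞]). -/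
open Filter Set MeasureTheory

/-- asymptotics of Lagrange multipliers, case p ∈ (0,1). -/
theorem lagrange_multiplier_pos_p_case
    (p : ℝ) (hp0 : 0 < p) (hp1 : p < 1)
    (U' : ℝ → ℝ) (hU'pos : ∀ x ∈ Ioi (0:ℝ), 0 < U' x)
    (hU'asymp : Tendsto (fun x => U' x * x ^ (1 - p)) atTop (nhds 1))
    {Ω : Type*} [MeasurableSpace Ω] (P : Measure Ω) [IsProbabilityMeasure P]
    (X : ℕ → Ω → ℝ) (α : ℕ → ℝ)
    (hXm : ∀ n, Measurable (X n)) (hXpos : ∀ n, ∀ᵐ ω ∂P, 0 < X n ω)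
    (hαpos : ∀ n, 0 < α n)
    (hfocint : ∀ n, Integrable (fun ω => U' (X n ω) * X n ω) P)
    (hfoc : ∀ n, ∫ ω, U' (X n ω) * X n ω ∂P = α n)
    (hsmall : ∀ M > (0:ℝ),
      Tendsto (fun n => (1 / α n) *
          ∫ ω, Set.indicator {ω | X n ω ≤ M} (fun ω => U' (X n ω) * X n ω) ω ∂P)
        atTop (nhds 0)) :
    1 ≤ liminf (fun n =>
        ENNReal.ofReal (1 / α n) * ∫⁻ ω, ENNReal.ofReal (X n ω ^ p) ∂P) atTop := by
  refine le_of_forall_lt_imp_le_of_dense fun a ha => ?_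
  lift a to NNReal using ha.ne_top
  have hc1 : (a : ℝ) < 1 := by exact_mod_cast ha
  have hc0 : (0 : ℝ) ≤ a := a.2
  set ε : ℝ := (1 - a) / 2 with hε
  have hε0 : 0 < ε := by linarith
  have hcε : (a : ℝ) * (1 + ε) ≤ 1 - ε := by rw [hε]; nlinarith [sq_nonneg (1 - (a : ℝ))]
  obtain ⟨M, hM⟩ := eventually_atTop.1 (hU'asymp.eventually (gt_mem_nhds (by linarith : 1 < 1 + ε)))
  have hM' : ∀ x, 0 < x → M ≤ x → U' x * x ≤ (1 + ε) * x ^ p := fun x hx hMx => by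
    have hpow : x = x ^ (1 - p) * x ^ p := by rw [← Real.rpow_add hx]; simp
    calc U' x * x = U' x * x ^ (1 - p) * x ^ p := by rw [mul_assoc, ← hpow]
      _ ≤ _ := mul_le_mul_of_nonneg_right (hM x hMx).le (Real.rpow_nonneg hx.le p)
  refine le_liminf_of_le (by isBoundedDefault) ?_
  filter_upwards [(hsmall (max M 1) (by positivity)).eventually (gt_mem_nhds hε0)] with n hn
  have hα := hαpos n
  have hpow0 : 0 ≤ᵐ[P] fun ω => X n ω ^ p := by
    filter_upwards [hXpos n] with ω hω using Real.rpow_nonneg hω.le p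
  have hpowm : AEStronglyMeasurable (fun ω => X n ω ^ p) P :=
    ((hXm n).pow_const p).aestronglyMeasurable
  by_cases hint : Integrable (fun ω => X n ω ^ p) P
  · rw [← ofReal_integral_eq_lintegral_ofReal hint hpow0,
      ← ENNReal.ofReal_mul (by positivity), ← ENNReal.ofReal_coe_nnreal]
    apply ENNReal.ofReal_le_ofReal
    have hsmall_int := (hfocint n).indicator (measurableSet_le (hXm n) measurable_const :
      MeasurableSet {ω | X n ω ≤ max M 1})
    have hle := integral_mono_ae (hfocint n) (hsmall_int.add (hint.const_mul (1 + ε))) (by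
      filter_upwards [hXpos n] with ω hω
      have hpω := Real.rpow_nonneg hω.le p
      by_cases h : X n ω ≤ max M 1
      · simp only [Pi.add_apply, indicator, mem_ofPred_eq, h, if_true]
        nlinarith
      · simp only [Pi.add_apply, indicator, mem_ofPred_eq, h, if_false, zero_add]
        exact hM' _ hω ((le_max_left _ _).trans (not_le.1 h).le))
    rw [hfoc, integral_add' hsmall_int (hint.const_mul (1 + ε)), integral_const_mul] at hle
    rw [one_div_mul_eq_div, div_lt_iff₀ hα] at hn
    rw [one_div_mul_eq_div, le_div_iff₀ hα]
    have hscaled : (1 + ε) * (a * α n) ≤ (1 + ε) * ∫ ω, X n ω ^ p ∂P := by nlinarith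
    exact le_of_mul_le_mul_left hscaled (by linarith)
  · have htop : ∫⁻ ω, ENNReal.ofReal (X n ω ^ p) ∂P = ⊤ := by
      by_contra h
      exact hint ((lintegral_ofReal_ne_top_iff_integrable hpowm hpow0).1 h)
    rw [htop, ENNReal.mul_top (by simpa using hα)]
    exact le_top
end

section
/- Let p < 0, set q = p/(p−1) ∈ (0,1), and let I : (0,∞) → (0,∞) be nonincreasing with lim_{y→0+} I(y)·y^{1/(1−p)} = 1. Let (Ω, 𝓕, P) be a probability space, and for each n ∈ ℕ let Y_n : Ω → ℝ be measurable with Y_n > 0 P-a.s., and let α_n > 0 be constants such that E[Y_n · I(α_n Y_n)] = 1 for every n. If lim_{n→∞} E[Y_n] = 0, then liminf_{n→∞} α_n^{−1/(1−p)} · E[Y_n^q] ≥ 1 (the expectations E[Y_n^q] being taken in [0,∞]). -/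
open Filter Set MeasureTheory

/-- An antitone function on `(0, ∞)` asymptotic to `y ^ (-a)` at `0` is bounded on `(0, ∞)` by
`b * y ^ (-a)` plus a constant, for every `b > 1`. -/
theorem exists_le_const_mul_rpow_add_const {I : ℝ → ℝ} {a b : ℝ}
    (hIanti : AntitoneOn I (Ioi 0)) (hIpos : ∀ y ∈ Ioi (0:ℝ), 0 < I y)
    (hIasymp : Tendsto (fun y => I y * y ^ a) (nhdsWithin 0 (Ioi 0)) (nhds 1)) (hb : 1 < b) :
    ∃ C, 0 ≤ C ∧ ∀ y, 0 < y → I y ≤ b * y ^ (-a) + C := by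
  obtain ⟨δ, hδ, hsub⟩ := mem_nhdsGT_iff_exists_Ioo_subset.1 (hIasymp.eventually_lt_const hb)
  refine ⟨I δ, (hIpos δ hδ).le, fun y hy => ?_⟩
  have hya : 0 < y ^ a := Real.rpow_pos_of_pos hy a
  rw [Real.rpow_neg hy.le, ← div_eq_mul_inv]
  rcases lt_or_ge y δ with h | h
  · have h1 : I y * y ^ a < b := hsub ⟨hy, h⟩
    have h2 : I y ≤ b / y ^ a := (le_div_iff₀ hya).2 h1.le
    linarith [hIpos δ hδ]
  · have h1 : I y ≤ I δ := hIanti hδ hy h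
    have h2 : 0 < b / y ^ a := by positivity
    linarith

/-- Integrating the bound `I y ≤ b * y ^ (-a) + C` in the first-order condition
`E[Z * I (α * Z)] = 1`. -/
theorem one_le_of_integral_mul_eq_one {Ω : Type*} [MeasurableSpace Ω] (P : Measure Ω)
    {Z : Ω → ℝ} {I : ℝ → ℝ} {a b C α : ℝ} (hZm : Measurable Z) (hZpos : ∀ᵐ ω ∂P, 0 < Z ω)
    (hα : 0 < α) (hZint : Integrable Z P) (hIpos : ∀ y ∈ Ioi (0:ℝ), 0 < I y)
    (hfocint : Integrable (fun ω => Z ω * I (α * Z ω)) P)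
    (hfoc : ∫ ω, Z ω * I (α * Z ω) ∂P = 1) (hb : 0 ≤ b) (hC : 0 ≤ C)
    (hbound : ∀ y, 0 < y → I y ≤ b * y ^ (-a) + C) :
    1 ≤ ENNReal.ofReal b *
        (ENNReal.ofReal (α ^ (-a)) * ∫⁻ ω, ENNReal.ofReal (Z ω ^ (1 - a)) ∂P) +
      ENNReal.ofReal (C * ∫ ω, Z ω ∂P) := by
  have hαa : 0 ≤ α ^ (-a) := Real.rpow_nonneg hα.le _
  calc (1 : ENNReal)
      = ENNReal.ofReal (∫ ω, Z ω * I (α * Z ω) ∂P) := by rw [hfoc, ENNReal.ofReal_one]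
    _ = ∫⁻ ω, ENNReal.ofReal (Z ω * I (α * Z ω)) ∂P :=
        ofReal_integral_eq_lintegral_ofReal hfocint
          (hZpos.mono fun ω h => (mul_pos h (hIpos _ (mul_pos hα h))).le)
    _ ≤ ∫⁻ ω, (ENNReal.ofReal b * (ENNReal.ofReal (α ^ (-a)) * ENNReal.ofReal (Z ω ^ (1 - a))) +
          ENNReal.ofReal C * ENNReal.ofReal (Z ω)) ∂P := by
        refine lintegral_mono_ae (hZpos.mono fun ω h => ?_)
        have hZa : 0 ≤ Z ω ^ (1 - a) := Real.rpow_nonneg h.le _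
        rw [← ENNReal.ofReal_mul hαa, ← ENNReal.ofReal_mul hb, ← ENNReal.ofReal_mul hC,
          ← ENNReal.ofReal_add (by positivity) (by positivity)]
        refine ENNReal.ofReal_le_ofReal ?_
        calc Z ω * I (α * Z ω) ≤ Z ω * (b * (α * Z ω) ^ (-a) + C) :=
              mul_le_mul_of_nonneg_left (hbound _ (mul_pos hα h)) h.le
          _ = b * (α ^ (-a) * Z ω ^ (1 - a)) + C * Z ω := by
              rw [Real.mul_rpow hα.le h.le, sub_eq_add_neg, Real.rpow_add h, Real.rpow_one]
              ring
    _ = _ := by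
        rw [lintegral_add_right _ (by fun_prop), lintegral_const_mul _ (by fun_prop),
          lintegral_const_mul _ (by fun_prop), lintegral_const_mul _ (by fun_prop),
          ENNReal.ofReal_mul hC,
          ofReal_integral_eq_lintegral_ofReal hZint (hZpos.mono fun ω h => h.le)]

/-- asymptotics of Lagrange multipliers, case p < 0. -/
theorem lagrange_multiplier_neg_p_case
    (p q : ℝ) (hp : p < 0) (hq : q = p / (p - 1))
    (I : ℝ → ℝ) (hIanti : AntitoneOn I (Ioi 0)) (hIpos : ∀ y ∈ Ioi (0:ℝ), 0 < I y)
    (hIasymp : Tendsto (fun y => I y * y ^ (1 / (1 - p))) (nhdsWithin 0 (Ioi 0)) (nhds 1))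
    {Ω : Type*} [MeasurableSpace Ω] (P : Measure Ω) [IsProbabilityMeasure P]
    (Y : ℕ → Ω → ℝ) (α : ℕ → ℝ)
    (hYm : ∀ n, Measurable (Y n)) (hYpos : ∀ n, ∀ᵐ ω ∂P, 0 < Y n ω)
    (hαpos : ∀ n, 0 < α n)
    (hYint : ∀ n, Integrable (Y n) P)
    (hfocint : ∀ n, Integrable (fun ω => Y n ω * I (α n * Y n ω)) P)
    (hfoc : ∀ n, ∫ ω, Y n ω * I (α n * Y n ω) ∂P = 1)
    (hYto0 : Tendsto (fun n => ∫ ω, Y n ω ∂P) atTop (nhds 0)) :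
    1 ≤ liminf (fun n =>
        ENNReal.ofReal (α n ^ (-(1 / (1 - p)))) * ∫⁻ ω, ENNReal.ofReal (Y n ω ^ q) ∂P)
      atTop := by
  rw [hq, show p / (p - 1) = 1 - 1 / (1 - p) by
    have h1 : p - 1 ≠ 0 := by linarith
    have h2 : 1 - p ≠ 0 := by linarith
    field_simp
    ring]
  refine le_of_forall_lt fun c hc => ?_
  obtain ⟨s, hcs, hs1⟩ := exists_between hc
  obtain ⟨r, hsr, hr1⟩ := ENNReal.lt_iff_exists_nnreal_btwn.1 hs1
  have hr0 : (0 : ℝ) < r := by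
    exact_mod_cast (zero_le (a := s)).trans_lt hsr
  replace hr1 : (r : ℝ) < 1 := by exact_mod_cast hr1
  have hb1 : 1 < (1 + 1 / (r : ℝ)) / 2 := by
    have := (one_lt_div hr0).2 hr1
    linarith
  have hbr : (1 + 1 / (r : ℝ)) / 2 * r < 1 := by
    have : (1 + 1 / (r : ℝ)) / 2 * r = (r + 1) / 2 := by field_simp
    linarith
  set b : ℝ := (1 + 1 / (r : ℝ)) / 2
  obtain ⟨C, hC, hbound⟩ := exists_le_const_mul_rpow_add_const hIanti hIpos hIasymp hb1
  have hsmall : ∀ᶠ n in atTop, C * ∫ ω, Y n ω ∂P < 1 - b * r := by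
    have h := hYto0.const_mul C
    rw [mul_zero] at h
    exact h.eventually_lt_const (by linarith)
  refine (hcs.trans hsr).trans_le (le_liminf_of_le (by isBoundedDefault) ?_)
  filter_upwards [hsmall] with n hn
  by_contra! hlt
  have hEY : 0 ≤ ∫ ω, Y n ω ∂P :=
    integral_nonneg_of_ae ((hYpos n).mono fun ω h => h.le)
  have key := one_le_of_integral_mul_eq_one P (hYm n) (hYpos n) (hαpos n) (hYint n) hIpos
    (hfocint n) (hfoc n) (by linarith : 0 ≤ b) hC hbound
  have h2 : (1 : ENNReal) ≤ ENNReal.ofReal (b * r + C * ∫ ω, Y n ω ∂P) := by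
    rw [ENNReal.ofReal_add (by positivity) (by positivity),
      ENNReal.ofReal_mul (by linarith : 0 ≤ b), ENNReal.ofReal_coe_nnreal]
    exact key.trans (by gcongr)
  rw [ENNReal.one_le_ofReal] at h2
  linarith
end

section
/- Let (Ω, 𝓕) be a measurable space, (P_n)_{n∈ℕ} a sequence of probability measures on (Ω, 𝓕), p < 1, C > 0, and let U′ : (0,∞) → (0,∞) be nonincreasing and strictly positive. For each n let X_n, X̃_n : Ω → ℝ be measurable and strictly positive P_n-a.s. Assume: (i) ∫ U′(X_n) · X̃_n^{1−p} dP_n ≤ C for all sufficiently large n, and (ii) for every M > 0, lim_{n→∞} P_n(X̃_n ≤ M) = 0. Then for every N > 0, lim_{n→∞} P_n(X_n ≤ N) = 0. -/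
open Filter Set MeasureTheory

/-- A Markov-type bound on a measurable set, with no measurability assumption on the integrand. -/
theorem measure_le_ofReal_div_of_forall_le {Ω : Type*} [MeasurableSpace Ω] {μ : Measure Ω}
    {f : Ω → ℝ} {s : Set Ω} (hs : MeasurableSet s) {a C : ℝ} (ha : 0 < a)
    (hf : ∀ ω ∈ s, a ≤ f ω) (hC : ∫⁻ ω, ENNReal.ofReal (f ω) ∂μ ≤ ENNReal.ofReal C) :
    μ s ≤ ENNReal.ofReal (C / a) := by
  rw [ENNReal.ofReal_div_of_pos ha,
    ENNReal.le_div_iff_mul_le (Or.inl (by simpa using ha)) (Or.inl ENNReal.ofReal_ne_top)]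
  calc μ s * ENNReal.ofReal a = ∫⁻ _ in s, ENNReal.ofReal a ∂μ := by
        rw [setLIntegral_const, mul_comm]
    _ ≤ ∫⁻ ω in s, ENNReal.ofReal (f ω) ∂μ :=
        setLIntegral_mono' hs fun ω hω => ENNReal.ofReal_le_ofReal (hf ω hω)
    _ ≤ ∫⁻ ω, ENNReal.ofReal (f ω) ∂μ := setLIntegral_le_lintegral _ _
    _ ≤ ENNReal.ofReal C := hC

/-- the generic investor's optimal wealth is unbounded in probability
under the myopic measures. -/
theorem generic_wealth_unbounded
    {Ω : Type*} [MeasurableSpace Ω] (P : ℕ → Measure Ω)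
    (hP : ∀ n, IsProbabilityMeasure (P n))
    (p : ℝ) (hp : p < 1) (C : ℝ) (hC : 0 < C)
    (U' : ℝ → ℝ) (hU'anti : AntitoneOn U' (Ioi 0)) (hU'pos : ∀ x ∈ Ioi (0:ℝ), 0 < U' x)
    (X Xt : ℕ → Ω → ℝ)
    (hXm : ∀ n, Measurable (X n)) (hXtm : ∀ n, Measurable (Xt n))
    (hXpos : ∀ n, ∀ᵐ ω ∂(P n), 0 < X n ω)
    (hXtpos : ∀ n, ∀ᵐ ω ∂(P n), 0 < Xt n ω)
    (hbound : ∀ᶠ n in atTop,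
      ∫⁻ ω, ENNReal.ofReal (U' (X n ω) * Xt n ω ^ (1 - p)) ∂(P n) ≤ ENNReal.ofReal C)
    (hXt : ∀ M > (0:ℝ), Tendsto (fun n => P n {ω | Xt n ω ≤ M}) atTop (nhds 0)) :
    ∀ N > (0:ℝ), Tendsto (fun n => P n {ω | X n ω ≤ N}) atTop (nhds 0) := by
  intro N hN
  have hc : 0 < U' N := hU'pos N hN
  have hlim : Tendsto (fun M : ℝ => ENNReal.ofReal (C / (U' N * M ^ (1 - p)))) atTop (nhds 0) := by
    have h : Tendsto (fun M : ℝ => C / (U' N * M ^ (1 - p))) atTop (nhds 0) :=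
      ((tendsto_rpow_atTop (sub_pos.2 hp)).const_mul_atTop hc).const_div_atTop C
    simpa using ENNReal.tendsto_ofReal h
  rw [ENNReal.tendsto_nhds_zero]
  intro ε hε
  have hε2 : 0 < ε / 2 := ENNReal.half_pos hε.ne'
  obtain ⟨M, hMε, hM⟩ :=
    ((ENNReal.tendsto_nhds_zero.1 hlim _ hε2).and (eventually_gt_atTop 0)).exists
  filter_upwards [hbound, ENNReal.tendsto_nhds_zero.1 (hXt M hM) _ hε2] with n hbn hMn
  have hs : MeasurableSet {ω | (0 < X n ω ∧ X n ω ≤ N) ∧ M < Xt n ω} :=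
    ((measurableSet_lt measurable_const (hXm n)).inter
      (measurableSet_le (hXm n) measurable_const)).inter
      (measurableSet_lt measurable_const (hXtm n))
  calc P n {ω | X n ω ≤ N}
      ≤ P n ({ω | Xt n ω ≤ M} ∪ {ω | (0 < X n ω ∧ X n ω ≤ N) ∧ M < Xt n ω}) := by
        refine measure_mono_ae ?_
        filter_upwards [hXpos n] with ω hω hωN
        exact (le_or_gt (Xt n ω) M).imp id fun h => ⟨⟨hω, hωN⟩, h⟩
    _ ≤ P n {ω | Xt n ω ≤ M} + P n {ω | (0 < X n ω ∧ X n ω ≤ N) ∧ M < Xt n ω} :=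
        measure_union_le _ _
    _ ≤ ε / 2 + ε / 2 := by
        refine add_le_add hMn (le_trans ?_ hMε)
        refine measure_le_ofReal_div_of_forall_le hs (mul_pos hc (Real.rpow_pos_of_pos hM _)) ?_ hbn
        rintro ω ⟨⟨hω, hωN⟩, hωM⟩
        have hU : U' N ≤ U' (X n ω) := hU'anti hω hN hωN
        exact mul_le_mul hU (Real.rpow_le_rpow hM.le hωM.le (sub_pos.2 hp).le)
          (Real.rpow_nonneg hM.le _) (hc.le.trans hU)
    _ = ε := ENNReal.add_halves ε
end

section
/- Let p < 1 be real, R > 0, and suppose R^{1/(1−p)} ≤ r ≤ 1. Then 0 ≤ (1 − R·r^{p−1})(1 − r) ≤ (1 − R)(1 − R^{1/(1−p)}). -/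
/-- pointwise estimate on the event {R^(1/(1−p)) ≤ r ≤ 1}. -/
theorem pointwise_estimate_lower_branch
    (p : ℝ) (hp : p < 1) (R r : ℝ) (hR : 0 < R)
    (hr1 : R ^ (1 / (1 - p)) ≤ r) (hr2 : r ≤ 1) :
    0 ≤ (1 - R * r ^ (p - 1)) * (1 - r) ∧
      (1 - R * r ^ (p - 1)) * (1 - r) ≤ (1 - R) * (1 - R ^ (1 / (1 - p))) := by
  have hq : 0 < 1 - p := sub_pos.2 hp
  have hr : 0 < r := (Real.rpow_pos_of_pos hR _).trans_le hr1
  have hRr : R ≤ r ^ (1 - p) := by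
    have h := Real.rpow_le_rpow (Real.rpow_nonneg hR.le _) hr1 hq.le
    rwa [← Real.rpow_mul hR.le, one_div_mul_cancel hq.ne', Real.rpow_one] at h
  have hle : R * r ^ (p - 1) ≤ 1 := by
    calc R * r ^ (p - 1) ≤ r ^ (1 - p) * r ^ (p - 1) := by gcongr
      _ = 1 := by rw [← Real.rpow_add hr]; simp
  have hge : 1 ≤ r ^ (p - 1) :=
    Real.one_le_rpow_of_pos_of_le_one_of_nonpos hr hr2 (by linarith)
  have hRle : R ≤ R * r ^ (p - 1) := le_mul_of_one_le_right hR.le hge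
  exact ⟨mul_nonneg (by linarith) (by linarith),
    mul_le_mul (by linarith) (by linarith) (by linarith) (by linarith)⟩
end

section
/- Let p < 1 be real, let (Ω, 𝓕) be a measurable space, (P_n)_{n∈ℕ} a sequence of probability measures on (Ω, 𝓕), and for each n let r_n, R_n : Ω → ℝ be measurable and strictly positive P_n-a.s. Assume: (i) lim_{n→∞} ∫ |1 − R_n·r_n^{p−1}|·|r_n − 1| dP_n = 0, and (ii) for every δ > 0, lim_{n→∞} P_n(|R_n − 1| ≥ δ) = 0. Then for every ε > 0, lim_{n→∞} P_n(|r_n − 1| ≥ ε) = 0. -/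
open Filter Set MeasureTheory

/-- Separation of `R * x ^ (p - 1)` from `1` for `x` far above `1` and `R` near `1`. -/
lemma exists_le_abs_one_sub_mul_rpow_of_one_add_le {p ε : ℝ} (hp : p < 1) (hε : 0 < ε) :
    ∃ δ > (0:ℝ), ∃ c > (0:ℝ), ∀ x y : ℝ, 1 + ε ≤ x → |y - 1| < δ →
      c ≤ |1 - y * x ^ (p - 1)| := by
  have ha0 : 0 < (1 + ε) ^ (p - 1) := by positivity
  have ha1 : (1 + ε) ^ (p - 1) < 1 :=
    Real.rpow_lt_one_of_one_lt_of_neg (by linarith) (by linarith)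
  have hmono (x : ℝ) (hx : 1 + ε ≤ x) : x ^ (p - 1) ≤ (1 + ε) ^ (p - 1) :=
    Real.rpow_le_rpow_of_nonpos (by linarith) hx (by linarith)
  generalize (1 + ε) ^ (p - 1) = a at ha0 ha1 hmono
  refine ⟨(1 - a) / 2, by linarith, (1 - a) / 2, by linarith, fun x y hx hy => ?_⟩
  have hx0 : 0 < x ^ (p - 1) := Real.rpow_pos_of_pos (by linarith) _
  have hmul : y * x ^ (p - 1) ≤ (1 + (1 - a) / 2) * a :=
    mul_le_mul (by linarith [(abs_lt.mp hy).2]) (hmono x hx) hx0.le (by linarith)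
  exact le_trans (by nlinarith) (le_abs_self _)

/-- Separation of `R * x ^ (p - 1)` from `1` for `x` far below `1` and `R` near `1`. -/
lemma exists_le_abs_one_sub_mul_rpow_of_le_one_sub {p ε : ℝ} (hp : p < 1) (hε : 0 < ε) :
    ∃ δ > (0:ℝ), ∃ c > (0:ℝ), ∀ x y : ℝ, 0 < x → x ≤ 1 - ε → |y - 1| < δ →
      c ≤ |1 - y * x ^ (p - 1)| := by
  rcases le_or_gt 1 ε with h | h
  · exact ⟨1, one_pos, 1, one_pos, fun x y hx hx' _ => by linarith⟩
  have hb1 : 1 < (1 - ε) ^ (p - 1) :=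
    Real.one_lt_rpow_of_pos_of_lt_one_of_neg (by linarith) (by linarith) (by linarith)
  have hmono (x : ℝ) (hx0 : 0 < x) (hx : x ≤ 1 - ε) : (1 - ε) ^ (p - 1) ≤ x ^ (p - 1) :=
    Real.rpow_le_rpow_of_nonpos hx0 hx (by linarith)
  generalize (1 - ε) ^ (p - 1) = b at hb1 hmono
  have hb0 : 0 < b := by linarith
  refine ⟨(b - 1) / (2 * b), div_pos (by linarith) (by linarith), (b - 1) / 2, by linarith,
    fun x y hx0 hx hy => ?_⟩
  have hδ : 1 - (b - 1) / (2 * b) = (b + 1) / (2 * b) := by field_simp; ring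
  have hy' : (b + 1) / (2 * b) ≤ y := by linarith [(abs_lt.mp hy).1]
  have hmul : (b + 1) / (2 * b) * b ≤ y * x ^ (p - 1) :=
    mul_le_mul hy' (hmono x hx0 hx) hb0.le (le_trans (by positivity) hy')
  have hhalf : (b + 1) / (2 * b) * b = (b + 1) / 2 := by field_simp
  exact le_trans (by linarith) (neg_le_abs _)

lemma exists_le_abs_one_sub_mul_rpow_mul_abs_sub_one {p ε : ℝ} (hp : p < 1) (hε : 0 < ε) :
    ∃ δ > (0:ℝ), ∃ c > (0:ℝ), ∀ x y : ℝ, 0 < x → ε ≤ |x - 1| → |y - 1| < δ →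
      c ≤ |1 - y * x ^ (p - 1)| * |x - 1| := by
  obtain ⟨δ₁, hδ₁, c₁, hc₁, h₁⟩ := exists_le_abs_one_sub_mul_rpow_of_one_add_le hp hε
  obtain ⟨δ₂, hδ₂, c₂, hc₂, h₂⟩ := exists_le_abs_one_sub_mul_rpow_of_le_one_sub hp hε
  refine ⟨min δ₁ δ₂, lt_min hδ₁ hδ₂, min c₁ c₂ * ε, mul_pos (lt_min hc₁ hc₂) hε,
    fun x y hx hxε hy => mul_le_mul ?_ hxε hε.le (abs_nonneg _)⟩
  rcases le_abs.mp hxε with h | h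
  · exact (min_le_left _ _).trans (h₁ x y (by linarith) (hy.trans_le (min_le_left _ _)))
  · exact (min_le_right _ _).trans (h₂ x y hx (by linarith) (hy.trans_le (min_le_right _ _)))

/-- convergence of the ratio of optimal wealths to 1 in probability
under the myopic measures. -/
theorem ratio_converges_in_probability
    (p : ℝ) (hp : p < 1)
    {Ω : Type*} [MeasurableSpace Ω] (P : ℕ → Measure Ω)
    (hP : ∀ n, IsProbabilityMeasure (P n))
    (r R : ℕ → Ω → ℝ)
    (hrm : ∀ n, Measurable (r n)) (hRm : ∀ n, Measurable (R n))
    (hrpos : ∀ n, ∀ᵐ ω ∂(P n), 0 < r n ω)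
    (hRpos : ∀ n, ∀ᵐ ω ∂(P n), 0 < R n ω)
    (hL1 : Tendsto (fun n =>
        ∫⁻ ω, ENNReal.ofReal (|1 - R n ω * r n ω ^ (p - 1)| * |r n ω - 1|) ∂(P n))
      atTop (nhds 0))
    (hRconv : ∀ δ > (0:ℝ),
      Tendsto (fun n => P n {ω | δ ≤ |R n ω - 1|}) atTop (nhds 0)) :
    ∀ ε > (0:ℝ),
      Tendsto (fun n => P n {ω | ε ≤ |r n ω - 1|}) atTop (nhds 0) := by
  intro ε hε
  obtain ⟨δ, hδ, c, hc, hsep⟩ := exists_le_abs_one_sub_mul_rpow_mul_abs_sub_one hp hε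
  have hc0 : ENNReal.ofReal c ≠ 0 := (ENNReal.ofReal_pos.mpr hc).ne'
  have hbound := (hRconv δ hδ).add
    (ENNReal.Tendsto.div_const (b := ENNReal.ofReal c) hL1 (Or.inr hc0))
  rw [ENNReal.zero_div, add_zero] at hbound
  refine tendsto_of_tendsto_of_tendsto_of_le_of_le tendsto_const_nhds hbound
    (fun n => zero_le) fun n => ?_
  set f : Ω → ENNReal :=
    fun ω => ENNReal.ofReal (|1 - R n ω * r n ω ^ (p - 1)| * |r n ω - 1|)
  have hf : Measurable f := by
    have := hrm n
    have := hRm n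
    fun_prop
  calc P n {ω | ε ≤ |r n ω - 1|}
      ≤ P n ({ω | δ ≤ |R n ω - 1|} ∪ {ω | ENNReal.ofReal c ≤ f ω}) := by
        refine measure_mono_ae ?_
        filter_upwards [hrpos n] with ω hω hr
        rcases le_or_gt δ |R n ω - 1| with h | h
        · exact Or.inl h
        · exact Or.inr (ENNReal.ofReal_le_ofReal (hsep _ _ hω hr h))
    _ ≤ P n {ω | δ ≤ |R n ω - 1|} + P n {ω | ENNReal.ofReal c ≤ f ω} := measure_union_le _ _
    _ ≤ P n {ω | δ ≤ |R n ω - 1|} + (∫⁻ ω, f ω ∂(P n)) / ENNReal.ofReal c := by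
        gcongr
        exact meas_ge_le_lintegral_div hf.aemeasurable hc0 ENNReal.ofReal_ne_top
end

section
/- Let (Ω, 𝓕, (𝓕_t)_{t∈[0,T]}, P) be a filtered probability space and let 𝒳 be a set of [0,T]-indexed processes, each adapted to (𝓕_t) and strictly positive P-a.s. at every time. Let X̂ ∈ 𝒳 have the numéraire property: E[X′_T/X̂_T] ≤ 1 for every X′ ∈ 𝒳. Assume 𝒳 is closed under switching relative to X̂: for every X ∈ 𝒳, every s ≤ t ≤ T, and every A ∈ 𝓕_s, the process X̃ defined by X̃_u = X̂_u for u ∈ [0,s); X̃_u = (X̂_s · X_u/X_s)·1_A + X̂_u·1_{Ω∖A} for u ∈ [s,t); and X̃_u = (X̂_s · X_t/X_s)·(X̂_u/X̂_t)·1_A + X̂_u·1_{Ω∖A} for u ∈ [t,T], belongs to 𝒳. Then for every X ∈ 𝒳 with X_t/X̂_t integrable for all t, and every s ≤ t ≤ T, E[X_t/X̂_t | 𝓕_s] ≤ X_s/X̂_s P-a.s.; that is, the ratio X/X̂ is a P-supermartingale on [0,T]. -/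
open Filter Set MeasureTheory

/-- A conditional expectation is bounded above by an `m`-measurable function as soon as the
corresponding bound holds for integrals over `m`-measurable sets. -/
theorem condExp_ae_le_of_forall_setIntegral_le {Ω : Type*} {m m0 : MeasurableSpace Ω}
    {μ : Measure Ω} [IsFiniteMeasure μ] (hm : m ≤ m0) {f g : Ω → ℝ} (hf : Integrable f μ)
    (hg : Integrable g μ) (hgm : StronglyMeasurable[m] g)
    (h : ∀ A, MeasurableSet[m] A → ∫ ω in A, f ω ∂μ ≤ ∫ ω in A, g ω ∂μ) :
    μ[f | m] ≤ᵐ[μ] g := by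
  suffices μ[f | m] ≤ᵐ[μ.trim hm] g from ae_le_of_ae_le_trim this
  refine ae_le_of_forall_setIntegral_le (integrable_condExp.trim hm stronglyMeasurable_condExp)
    (hg.trim hm hgm) fun A hA _ => ?_
  rw [← setIntegral_trim hm stronglyMeasurable_condExp hA, ← setIntegral_trim hm hgm hA,
    setIntegral_condExp hm hf hA]
  exact h A hA

/-- If `∫ ω in A, Y ω / Z ω ∂μ ≤ μ.real A` for every `m`-measurable set `A` on which the
positive `m`-measurable function `Z` is bounded away from zero, then `μ[Y | m] ≤ Z`. -/
theorem condExp_ae_le_of_forall_setIntegral_div_le {Ω : Type*} {m m0 : MeasurableSpace Ω}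
    {μ : Measure Ω} [IsFiniteMeasure μ] (hm : m ≤ m0) {Y Z : Ω → ℝ} (hY : Integrable Y μ)
    (hZ : Measurable[m] Z) (hZpos : ∀ᵐ ω ∂μ, 0 < Z ω)
    (h : ∀ A, MeasurableSet[m] A → IntegrableOn (fun ω => Y ω / Z ω) A μ →
      ∫ ω in A, Y ω / Z ω ∂μ ≤ μ.real A) :
    μ[Y | m] ≤ᵐ[μ] Z := by
  have key : ∀ n : ℕ, ∀ᵐ ω ∂μ, 1 / ((n : ℝ) + 1) ≤ Z ω → (μ[Y | m]) ω ≤ Z ω := by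
    intro n
    have hε : (0 : ℝ) < 1 / ((n : ℝ) + 1) := by positivity
    set ε : ℝ := 1 / ((n : ℝ) + 1)
    let S : Set Ω := {ω | ε ≤ Z ω}
    have hS : MeasurableSet[m] S := measurableSet_le measurable_const hZ
    let g : Ω → ℝ := S.indicator fun ω => (Z ω)⁻¹
    have hg : StronglyMeasurable[m] g := (hZ.inv.indicator hS).stronglyMeasurable
    have hgY : Integrable (g * Y) μ := by
      refine hY.bdd_mul (c := ε⁻¹) (hg.mono hm).aestronglyMeasurable (ae_of_all _ fun ω => ?_)
      by_cases hω : ω ∈ S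
      · have hω' : ε ≤ Z ω := hω
        simp only [g, indicator_of_mem hω, norm_inv, Real.norm_eq_abs]
        exact inv_anti₀ hε (hω'.trans (le_abs_self _))
      · simp only [g, indicator_of_notMem hω, norm_zero]
        positivity
    have hgY_eq : g * Y = S.indicator fun ω => Y ω / Z ω := by
      ext ω
      by_cases hω : ω ∈ S <;> simp [g, hω, div_eq_inv_mul]
    have hle : μ[g * Y | m] ≤ᵐ[μ] S.indicator fun _ => (1 : ℝ) := by
      refine condExp_ae_le_of_forall_setIntegral_le hm hgY
        ((integrable_const _).indicator (hm _ hS)) (stronglyMeasurable_const.indicator hS)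
        fun A hA => ?_
      rw [hgY_eq, setIntegral_indicator (hm _ hS), setIntegral_indicator (hm _ hS)]
      rw [hgY_eq, integrable_indicator_iff (hm _ hS)] at hgY
      simpa using h _ (hA.inter hS) (hgY.mono_set inter_subset_right)
    filter_upwards [hle, condExp_mul_of_stronglyMeasurable_left hg hgY hY] with ω h₁ h₂ hω
    have hωS : ω ∈ S := hω
    rw [h₂, Pi.mul_apply, indicator_of_mem hωS] at h₁
    simp only [g, indicator_of_mem hωS] at h₁
    rwa [inv_mul_le_iff₀ (hε.trans_le hω), mul_one] at h₁
  filter_upwards [ae_all_iff.2 key, hZpos] with ω hω hpos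
  obtain ⟨n, hn⟩ := exists_nat_one_div_lt hpos
  exact hω n hn.le

/-- the ratio of any admissible wealth to a numéraire wealth in a
switching-closed class is a supermartingale. -/
theorem ratio_to_numeraire_is_supermartingale
    {Ω : Type*} {m0 : MeasurableSpace Ω} (P : Measure Ω) [IsProbabilityMeasure P]
    (T : ℝ) (hT : 0 ≤ T)
    (ℱ : ℝ → MeasurableSpace Ω) (hmono : Monotone ℱ) (hle : ∀ t, ℱ t ≤ m0)
    (𝒳 : Set (ℝ → Ω → ℝ))
    (hadapted : ∀ X ∈ 𝒳, ∀ t ∈ Icc (0:ℝ) T, Measurable[ℱ t] (X t))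
    (hpos : ∀ X ∈ 𝒳, ∀ t ∈ Icc (0:ℝ) T, ∀ᵐ ω ∂P, 0 < X t ω)
    (Xhat : ℝ → Ω → ℝ) (hXhat : Xhat ∈ 𝒳)
    (hnum : ∀ X' ∈ 𝒳, ∫ ω, X' T ω / Xhat T ω ∂P ≤ 1)
    (hswitch : ∀ X ∈ 𝒳, ∀ s t : ℝ, 0 ≤ s → s ≤ t → t ≤ T →
      ∀ A : Set Ω, MeasurableSet[ℱ s] A →
        (fun u ω =>
          if u < s then Xhat u ω
          else if u < t then
            A.indicator (fun ω' => Xhat s ω' * X u ω' / X s ω') ω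
              + Aᶜ.indicator (fun ω' => Xhat u ω') ω
          else
            A.indicator (fun ω' => Xhat s ω' * X t ω' / X s ω' * (Xhat u ω' / Xhat t ω')) ω
              + Aᶜ.indicator (fun ω' => Xhat u ω') ω) ∈ 𝒳) :
    ∀ X ∈ 𝒳, (∀ t ∈ Icc (0:ℝ) T, Integrable (fun ω => X t ω / Xhat t ω) P) →
      ∀ s t : ℝ, 0 ≤ s → s ≤ t → t ≤ T →
        ∀ᵐ ω ∂P, (P[fun ω' => X t ω' / Xhat t ω' | ℱ s]) ω ≤ X s ω / Xhat s ω := by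
  intro X hX hint s t hs hst htT
  have hsT : s ∈ Icc (0 : ℝ) T := ⟨hs, hst.trans htT⟩
  have ht : t ∈ Icc (0 : ℝ) T := ⟨hs.trans hst, htT⟩
  refine condExp_ae_le_of_forall_setIntegral_div_le (hle s) (hint t ht)
    ((hadapted X hX s hsT).div (hadapted Xhat hXhat s hsT)) ?_ fun A hA hA_int => ?_
  · filter_upwards [hpos X hX s hsT, hpos Xhat hXhat s hsT] with ω h₁ h₂ using div_pos h₁ h₂
  have hA' : MeasurableSet[m0] A := hle s A hA
  have h1 := hnum _ (hswitch X hX s t hs hst htT A hA)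
  simp only [not_lt.2 hsT.2, not_lt.2 htT, if_false] at h1
  rw [integral_congr_ae (g := fun ω =>
    A.indicator (fun ω => X t ω / Xhat t ω / (X s ω / Xhat s ω)) ω
      + Aᶜ.indicator (fun _ => (1 : ℝ)) ω),
    integral_add ((integrable_indicator_iff hA').2 hA_int)
      ((integrable_const _).indicator hA'.compl),
    integral_indicator hA', integral_indicator hA'.compl] at h1
  · have h2 : P.real Aᶜ = 1 - P.real A := probReal_compl_eq_one_sub hA'
    simp only [integral_const, measureReal_restrict_apply_univ, smul_eq_mul, mul_one, h2] at h1
    linarith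
  · filter_upwards [hpos Xhat hXhat T ⟨hT, le_rfl⟩] with ω hT_pos
    by_cases hω : ω ∈ A
    · simp only [indicator_of_mem hω, indicator_of_notMem (notMem_compl_iff.2 hω), add_zero]
      field_simp
    · simp only [indicator_of_notMem hω, indicator_of_mem (mem_compl hω), zero_add]
      exact div_self hT_pos.ne'
end
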